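/- Let G be an α_i-metric graph and x,y a pair of mutually distant vertices. Then every vertex v satisfies max{d(x,v), d(y,v)} ≤ e(v) ≤ max{d(x,v), d(y,v)} + 3i+2. -/

import Mathlib

open SimpleGraph

variable {V : Type*}

/-- `Itv G u v x` means `x` lies on a shortest `(u,v)`-path, i.e. `x ∈ I(u,v)`. -/
def Itv (G : SimpleGraph V) (u v x : V) : Prop :=
  G.dist u x + G.dist x v = G.dist u v

/-- `G` is an `α_i`-metric graph. -/
def AlphaI (G : SimpleGraph V) (i : ℕ) : Prop :=
  ∀ u v w x : V, Itv G u w v → Itv G v x w → G.Adj v w →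
    G.dist u v + G.dist v x ≤ G.dist u x + i

/-- Eccentricity of a vertex. -/
noncomputable def ecc (G : SimpleGraph V) [Fintype V] (v : V) : ℕ :=
  Finset.univ.sup (fun u => G.dist v u)

/-- Radius of the graph. -/
noncomputable def grad (G : SimpleGraph V) [Fintype V] [Nonempty V] : ℕ :=
  Finset.univ.inf' Finset.univ_nonempty (fun v => ecc G v)

/-- Diameter of the graph. -/
noncomputable def gdiam (G : SimpleGraph V) [Fintype V] : ℕ :=
  Finset.univ.sup (fun v => ecc G v)

theorem SimpleGraph.Connected.exists_adj_dist_add_one_eq {G : SimpleGraph V} (hG : G.Connected)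
    {u v : V} (huv : u ≠ v) : ∃ w, G.Adj u w ∧ G.dist w v + 1 = G.dist u v := by
  obtain ⟨p, hp⟩ := hG.exists_walk_length_eq_dist u v
  cases p with
  | nil => exact absurd rfl huv
  | @cons _ w _ h q =>
    refine ⟨w, h, ?_⟩
    have hq := dist_le q
    have htri := hG.dist_triangle (u := u) (v := w) (w := v)
    have huw := dist_eq_one_iff_adj.mpr h
    rw [Walk.length_cons] at hp
    omega

/-- Every slice of an interval is nonempty. -/
theorem SimpleGraph.Connected.exists_dist_eq_of_le {G : SimpleGraph V} (hG : G.Connected)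
    (x y : V) {p : ℕ} (hp : p ≤ G.dist x y) :
    ∃ c, G.dist x c = p ∧ p + G.dist c y = G.dist x y := by
  induction p with
  | zero => exact ⟨x, by simp, by simp⟩
  | succ p ih =>
    obtain ⟨c, hxc, hcy⟩ := ih (by omega)
    have hne : c ≠ y := by
      rintro rfl
      rw [dist_self] at hcy
      omega
    obtain ⟨w, hcw, hwy⟩ := hG.exists_adj_dist_add_one_eq hne
    have h₁ := dist_eq_one_iff_adj.mpr hcw
    have h₂ := hG.dist_triangle (u := x) (v := c) (w := w)
    have h₃ := hG.dist_triangle (u := x) (v := w) (w := y)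
    exact ⟨w, by omega, by omega⟩

/-- In an `α_i`-metric graph, slices of intervals have diameter at most `i + 1`. -/
theorem AlphaI.dist_le_of_mem_slice {G : SimpleGraph V} {i : ℕ} (hα : AlphaI G i)
    (hG : G.Connected) {x y a b : V} (ha : G.dist x a + G.dist a y = G.dist x y)
    (hb : G.dist x b + G.dist b y = G.dist x y) (hab : G.dist x a = G.dist x b) :
    G.dist a b ≤ i + 1 := by
  induction hn : G.dist a y generalizing a b with
  | zero =>
    have hay : a = y := hG.dist_eq_zero_iff.mp hn
    have hby : b = y := hG.dist_eq_zero_iff.mp (by omega)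
    simp [hay, hby]
  | succ n ih =>
    have hay : a ≠ y := by
      rintro rfl
      simp at hn
    have hby : b ≠ y := by
      rintro rfl
      rw [dist_self] at hb
      omega
    obtain ⟨a', haa, ha'⟩ := hG.exists_adj_dist_add_one_eq hay
    obtain ⟨b', hbb, hb'⟩ := hG.exists_adj_dist_add_one_eq hby
    have haa1 := dist_eq_one_iff_adj.mpr haa
    have hbb1 := dist_eq_one_iff_adj.mpr hbb
    have hxa := hG.dist_triangle (u := x) (v := a) (w := a')
    have hxa' := hG.dist_triangle (u := x) (v := a') (w := y)
    have hxb := hG.dist_triangle (u := x) (v := b) (w := b')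
    have hxb' := hG.dist_triangle (u := x) (v := b') (w := y)
    have key := ih (a := a') (b := b') (by omega) (by omega) (by omega) (by omega)
    have t₁ := hG.dist_triangle (u := b) (v := a) (w := a')
    have t₂ := hG.dist_triangle (u := b) (v := a') (w := a)
    have t₃ := hG.dist_triangle (u := b) (v := b') (w := a')
    have α₁ := hα b a a' y
    have α₂ := hα b a' a x
    have α₃ := hα x b b' a'
    have hs := haa.symm
    simp only [Itv, haa, hbb, hs, forall_const] at α₁ α₂ α₃
    rw [dist_comm (u := a') (v := b')] at key
    rw [dist_comm (u := a') (v := a)] at t₂ α₂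
    rw [dist_comm (u := a) (v := x), dist_comm (u := a') (v := x),
      dist_comm (u := b) (v := x)] at α₂
    rw [dist_comm (u := a) (v := b)]
    omega

/-- Every slice of an interval `I(x,y)` of an `α_i`-metric graph contains a vertex which is either
equal to `v` or lies, up to the error `i`, on a shortest path from `v` to `x` or to `y`. -/
theorem AlphaI.exists_mem_slice {G : SimpleGraph V} {i : ℕ} (hα : AlphaI G i)
    (hG : G.Connected) {x y c : V} (v : V) (hc : G.dist x c + G.dist c y = G.dist x y) :
    ∃ c', G.dist x c' = G.dist x c ∧ G.dist c' y = G.dist c y ∧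
      (c' = v ∨ G.dist v c' + G.dist x c' ≤ G.dist x v + i ∨
        G.dist v c' + G.dist c' y ≤ G.dist y v + i) := by
  induction hn : G.dist c v generalizing c with
  | zero => exact ⟨c, rfl, rfl, .inl (hG.dist_eq_zero_iff.mp hn)⟩
  | succ n ih =>
    have hcv : c ≠ v := by
      rintro rfl
      simp at hn
    obtain ⟨w, hcw, hw⟩ := hG.exists_adj_dist_add_one_eq hcv
    have hcw1 := dist_eq_one_iff_adj.mpr hcw
    have hs := hcw.symm
    have αx := hα v w c x
    have αy := hα v w c y
    have tx := hG.dist_triangle (u := x) (v := c) (w := w)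
    have ty := hG.dist_triangle (u := w) (v := c) (w := y)
    have txy := hG.dist_triangle (u := x) (v := w) (w := y)
    simp only [Itv, hs, forall_const] at αx αy
    rw [dist_comm (u := w) (v := c)] at αx αy ty
    rw [dist_comm (u := v) (v := w), dist_comm (u := v) (v := c)] at αx αy
    rw [dist_comm (u := w) (v := x), dist_comm (u := c) (v := x),
      dist_comm (u := v) (v := x)] at αx
    rw [dist_comm (u := v) (v := y)] at αy
    by_cases h : G.dist x w ≤ G.dist x c ∧ G.dist w y ≤ G.dist c y
    · obtain ⟨c', h₁, h₂, h₃⟩ := ih (c := w) (by omega) (by omega)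
      exact ⟨c', by omega, by omega, h₃⟩
    · refine ⟨c, rfl, rfl, .inr ?_⟩
      rw [dist_comm (u := v) (v := c)]
      omega

theorem dist_le_ecc [Fintype V] (G : SimpleGraph V) (u v : V) : G.dist u v ≤ ecc G u :=
  Finset.le_sup (f := fun w => G.dist u w) (Finset.mem_univ v)

theorem stmt_12 [Fintype V] (G : SimpleGraph V) (hG : G.Connected) (i : ℕ)
    (hα : AlphaI G i) (x y : V)
    (hx : ecc G x = G.dist x y) (hy : ecc G y = G.dist x y) (v : V) :
    max (G.dist x v) (G.dist y v) ≤ ecc G v ∧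
    ecc G v ≤ max (G.dist x v) (G.dist y v) + 3 * i + 2 := by
  constructor
  · rw [dist_comm (u := x), dist_comm (u := y)]
    exact max_le (dist_le_ecc G v x) (dist_le_ecc G v y)
  refine Finset.sup_le fun z _ => ?_
  have hxz := hx ▸ dist_le_ecc G x z
  have hyz := hy ▸ dist_le_ecc G y z
  obtain ⟨c, hxc, hcy⟩ := hG.exists_dist_eq_of_le x y (Nat.div_le_self (G.dist x y) 2)
  obtain ⟨a, ha₁, ha₂, ha⟩ := hα.exists_mem_slice hG (x := x) (y := y) (c := c) v (by omega)
  obtain ⟨b, hb₁, hb₂, hb⟩ := hα.exists_mem_slice hG (x := x) (y := y) (c := c) z (by omega)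
  have hab := hα.dist_le_of_mem_slice hG (x := x) (y := y) (a := a) (b := b)
    (by omega) (by omega) (by omega)
  have t₁ := hG.dist_triangle (u := v) (v := a) (w := z)
  have t₂ := hG.dist_triangle (u := a) (v := b) (w := z)
  have t₃ := hG.dist_triangle (u := x) (v := v) (w := y)
  rw [dist_comm (u := v) (v := y)] at t₃
  rw [dist_comm (u := b) (v := z)] at t₂
  have hva : a = v → G.dist v a = 0 := by
    rintro rfl
    exact dist_self
  have hzb : b = z → G.dist z b = 0 := by
    rintro rfl
    exact dist_self
  have hva' := ha.imp_left hva
  have hzb' := hb.imp_left hzb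
  omega
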